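/- Let f ∈ K(z) be a rational function of degree d > 1, and let μ be a Radon probability measure on P^1_Berk(K) such that for every a ∈ P^1(K) \ E(f), the measures d^{-n}·(f^n)^*δ_a converge weakly to μ as n → ∞. Let D be an open subset of P^1_Berk(K) such that, for some sequence (n_j) in ℕ tending to ∞ and some rational function g ∈ K(z), the iterates f^{n_j} converge to g uniformly on D ∩ P^1(K) with respect to the chordal metric. Then D ∩ supp μ = ∅. -/

import Mathlib

open scoped Classical

open Polynomial Filter MeasureTheory Topology

variable (K : Type*) [NontriviallyNormedField K] [IsAlgClosed K] [CompleteSpace K]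
  [IsUltrametricDist K]

/-- The degree of a rational function: max of degrees of numerator and denominator. -/
noncomputable def rdeg (h : RatFunc K) : ℕ := max h.num.natDegree h.denom.natDegree

/-- Canonical homogeneous coordinates of a point of `P^1(K) = K ∪ {∞}`. -/
noncomputable def homCoord : OnePoint K → K × K :=
  OnePoint.rec (1, 0) (fun a => (a, 1))

/-- The (normalized) chordal metric on `P^1(K)`:
`[z,w] = |z0*w1 - z1*w0| / (max(|z0|,|z1|) * max(|w0|,|w1|))`. -/
noncomputable def chordal (x y : OnePoint K) : ℝ :=
  ‖(homCoord K x).1 * (homCoord K y).2 - (homCoord K x).2 * (homCoord K y).1‖ /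
    (max ‖(homCoord K x).1‖ ‖(homCoord K x).2‖ * max ‖(homCoord K y).1‖ ‖(homCoord K y).2‖)

/-- The action of a rational function on the projective line `P^1(K) = K ∪ {∞}`. -/
noncomputable def evalP1 (h : RatFunc K) : OnePoint K → OnePoint K :=
  OnePoint.rec
    (if h.denom.natDegree < h.num.natDegree then OnePoint.infty
      else ((h.num.coeff h.denom.natDegree / h.denom.leadingCoeff : K) : OnePoint K))
    (fun a => if h.denom.eval a = 0 then OnePoint.infty
      else ((h.num.eval a / h.denom.eval a : K) : OnePoint K))

/-- Composition of rational functions. -/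
noncomputable def rcomp (f g : RatFunc K) : RatFunc K :=
  RatFunc.eval (algebraMap K (RatFunc K)) g f

/-- Iterates of a rational function, as rational functions. -/
noncomputable def riter (f : RatFunc K) : ℕ → RatFunc K
  | 0 => RatFunc.X
  | n + 1 => rcomp K f (riter f n)

/-- The exceptional set `E(f) = {a : ⋃_{n ≥ 0} f⁻ⁿ(a) is finite}`. -/
def exceptionalSet (f : RatFunc K) : Set (OnePoint K) :=
  {a | Set.Finite {b : OnePoint K | ∃ n : ℕ, (evalP1 K f)^[n] b = a}}

/-- The Berkovich affine line `A^1(K)`: multiplicative seminorms on `K[z]`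
whose restriction to `K` is the absolute value of `K`. -/
structure BerkA1 where
  /-- the seminorm, as a function on polynomials -/
  toFun : Polynomial K → ℝ
  nonneg' : ∀ p, 0 ≤ toFun p
  map_mul' : ∀ p q, toFun (p * q) = toFun p * toFun q
  add_le' : ∀ p q, toFun (p + q) ≤ toFun p + toFun q
  restricts' : ∀ c : K, toFun (Polynomial.C c) = ‖c‖

/-- The topology of pointwise convergence on the Berkovich affine line. -/
instance : TopologicalSpace (BerkA1 K) :=
  TopologicalSpace.induced BerkA1.toFun Pi.topologicalSpace

/-- The Berkovich projective line `P^1_Berk(K)`, the one-point compactification of the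
Berkovich affine line. -/
abbrev BerkP1 := OnePoint (BerkA1 K)

/-- The evaluation seminorm `p ↦ ‖p(a)‖` attached to a classical point `a ∈ K`. -/
noncomputable def evalSeminorm (a : K) : BerkA1 K where
  toFun p := ‖p.eval a‖
  nonneg' p := norm_nonneg _
  map_mul' p q := by simp [norm_mul]
  add_le' p q := by simpa using norm_add_le (p.eval a) (q.eval a)
  restricts' c := by simp

/-- The canonical embedding of the classical projective line `P^1(K) = K ∪ {∞}`
into the Berkovich projective line. -/
noncomputable def iota : OnePoint K → BerkP1 K :=
  OnePoint.map (evalSeminorm K)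

noncomputable instance : MeasurableSpace (BerkP1 K) := borel _

instance : BorelSpace (BerkP1 K) := ⟨rfl⟩

/-- The support of a measure: points all of whose open neighborhoods have positive measure. -/
def msupport (μ : Measure (BerkP1 K)) : Set (BerkP1 K) :=
  {x | ∀ U : Set (BerkP1 K), IsOpen U → x ∈ U → 0 < μ U}

/-- Weak convergence of a sequence of measures on the Berkovich projective line:
integrals of every continuous real-valued function converge. -/
def WeakTendsto (μs : ℕ → Measure (BerkP1 K)) (μ : Measure (BerkP1 K)) : Prop :=
  ∀ φ : C(BerkP1 K, ℝ),
    Tendsto (fun n => ∫ x, φ x ∂(μs n)) atTop (𝓝 (∫ x, φ x ∂μ))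

/-- resultant-style polynomial whose roots (in the affine chart) are the solutions of `f = g`. -/
noncomputable def eqPoly (f g : RatFunc K) : Polynomial K :=
  f.num * g.denom - g.num * f.denom

/-- The multiplicity `ord_a [f = g]` of `a ∈ P^1(K)` as a root of the equation `f = g`;
at `∞` it is the degree deficiency `(deg f + deg g) - deg (eqPoly f g)`. -/
noncomputable def ordEq (f g : RatFunc K) : OnePoint K → ℕ :=
  OnePoint.rec ((rdeg K f + rdeg K g) - (eqPoly K f g).natDegree)
    (fun a => (eqPoly K f g).rootMultiplicity a)

/-- The multiplicity `deg_b(f)` of `b` as a solution of the equation `f(z) = a`. -/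
noncomputable def ordPull (f : RatFunc K) : OnePoint K → OnePoint K → ℕ :=
  OnePoint.rec
    (OnePoint.rec (rdeg K f - f.denom.natDegree) (fun b => f.denom.rootMultiplicity b))
    (fun x => ordEq K f (RatFunc.C x))

/-- The pullback measure `f^*δ_a = Σ_b deg_b(f)·δ_b` on the Berkovich projective line. -/
noncomputable def pullMeasure (f : RatFunc K) (a : OnePoint K) : Measure (BerkP1 K) :=
  Measure.sum fun b : OnePoint K => (ordPull K f a b : ENNReal) • Measure.dirac (iota K b)


/-! ### Homogeneous calculus on the projective line -/

set_option linter.unusedSectionVars false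

section aux

variable {K}

/-- The point `[u : v]` of the projective line. -/
noncomputable def auxPt (u v : K) : OnePoint K :=
  if v = 0 then OnePoint.infty else ((u / v : K) : OnePoint K)

/-- Value at a point of the degree `N` homogenization of a polynomial. -/
noncomputable def auxH (N : ℕ) (p : K[X]) : OnePoint K → K :=
  OnePoint.rec (p.coeff N) (fun b => p.eval b)

lemma auxH_infty (N : ℕ) (p : K[X]) : auxH N p OnePoint.infty = p.coeff N := rfl

lemma auxH_coe (N : ℕ) (p : K[X]) (b : K) : auxH N p (b : OnePoint K) = p.eval b := rfl

lemma evalP1_infty (h : RatFunc K) : evalP1 K h OnePoint.infty =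
    (if h.denom.natDegree < h.num.natDegree then OnePoint.infty
      else ((h.num.coeff h.denom.natDegree / h.denom.leadingCoeff : K) : OnePoint K)) := rfl

lemma evalP1_coe (h : RatFunc K) (a : K) : evalP1 K h (a : OnePoint K) =
    (if h.denom.eval a = 0 then OnePoint.infty
      else ((h.num.eval a / h.denom.eval a : K) : OnePoint K)) := rfl

lemma auxPt_eq {u v s t : K} (h1 : u ≠ 0 ∨ v ≠ 0) (h2 : s ≠ 0 ∨ t ≠ 0) (h : u * t = s * v) :
    auxPt u v = auxPt s t := by
  unfold auxPt
  by_cases hv : v = 0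
  · have hu : u ≠ 0 := by tauto
    have ht : t = 0 := by
      subst hv
      simpa [hu] using h
    simp [hv, ht]
  · have ht : t ≠ 0 := by
      rintro rfl
      have : s ≠ 0 := by tauto
      simp_all
    simp only [hv, ht, if_false]
    congr 1
    rw [div_eq_div_iff hv ht, h]

lemma auxH_mul {N M : ℕ} {p q : K[X]} (hp : p.natDegree ≤ N) (hq : q.natDegree ≤ M)
    (b : OnePoint K) : auxH (N + M) (p * q) b = auxH N p b * auxH M q b := by
  induction b using OnePoint.rec with
  | infty => simp only [auxH_infty]; exact coeff_mul_add_eq_of_natDegree_le hp hq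
  | coe b => simp [auxH_coe]

lemma auxH_pow {N : ℕ} {p : K[X]} (hp : p.natDegree ≤ N) (i : ℕ)
    (b : OnePoint K) : auxH (i * N) (p ^ i) b = auxH N p b ^ i := by
  induction b using OnePoint.rec with
  | infty => simp only [auxH_infty]; exact coeff_pow_of_natDegree_le hp
  | coe b => simp [auxH_coe]

lemma num_le_rdeg (h : RatFunc K) : h.num.natDegree ≤ rdeg K h := le_max_left _ _

lemma denom_le_rdeg (h : RatFunc K) : h.denom.natDegree ≤ rdeg K h := le_max_right _ _

lemma evalP1_eq (h : RatFunc K) (b : OnePoint K) :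
    evalP1 K h b = auxPt (auxH (rdeg K h) h.num b) (auxH (rdeg K h) h.denom b) := by
  induction b using OnePoint.rec with
  | infty =>
    rw [evalP1_infty, auxH_infty, auxH_infty, auxPt]
    by_cases hlt : h.denom.natDegree < h.num.natDegree
    · have : rdeg K h = h.num.natDegree := max_eq_left hlt.le
      rw [if_pos hlt, this, if_pos (coeff_eq_zero_of_natDegree_lt hlt)]
    · have : rdeg K h = h.denom.natDegree := max_eq_right (not_lt.mp hlt)
      rw [if_neg hlt, this, if_neg]
      · rfl
      · simpa using h.denom_ne_zero
  | coe b => rfl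

lemma eval_num_or_denom (h : RatFunc K) (b : K) : h.num.eval b ≠ 0 ∨ h.denom.eval b ≠ 0 := by
  by_contra! hc
  obtain ⟨u, v, huv⟩ := h.isCoprime_num_denom
  have := congrArg (Polynomial.eval b) huv
  simp [hc.1, hc.2] at this

lemma auxH_ne (h : RatFunc K) (b : OnePoint K) :
    auxH (rdeg K h) h.num b ≠ 0 ∨ auxH (rdeg K h) h.denom b ≠ 0 := by
  induction b using OnePoint.rec with
  | infty =>
    simp only [auxH_infty]
    by_cases hlt : h.denom.natDegree < h.num.natDegree
    · have : rdeg K h = h.num.natDegree := max_eq_left hlt.le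
      left
      rw [this]
      have : h.num ≠ 0 := by
        rintro h0
        simp [h0] at hlt
      simpa using this
    · have : rdeg K h = h.denom.natDegree := max_eq_right (not_lt.mp hlt)
      right
      rw [this]
      simpa using h.denom_ne_zero
  | coe b => exact eval_num_or_denom h b

lemma evalP1_of_div {h : RatFunc K} {P Q : K[X]} {N : ℕ} (hQ : Q ≠ 0)
    (hh : h = algebraMap K[X] (RatFunc K) P / algebraMap K[X] (RatFunc K) Q)
    (hP : P.natDegree ≤ N) (hQN : Q.natDegree ≤ N) (b : OnePoint K)
    (hne : auxH N P b ≠ 0 ∨ auxH N Q b ≠ 0) :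
    evalP1 K h b = auxPt (auxH N P b) (auxH N Q b) := by
  rw [evalP1_eq]
  apply auxPt_eq (auxH_ne h b) hne
  rw [← auxH_mul (num_le_rdeg h) hQN, ← auxH_mul hP (denom_le_rdeg h), add_comm]
  congr 1
  have h1 := h.num_div_denom.trans hh
  have hd : algebraMap K[X] (RatFunc K) h.denom ≠ 0 := by simpa using h.denom_ne_zero
  have hq : algebraMap K[X] (RatFunc K) Q ≠ 0 := by simpa using hQ
  rw [div_eq_div_iff hd hq] at h1
  apply RatFunc.algebraMap_injective K
  simpa using h1

/-- Homogenization of `A` in degree `D`. -/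
noncomputable def auxHm {R : Type*} [CommSemiring R] [Algebra K R] (D : ℕ) (A : K[X])
    (p q : R) : R :=
  ∑ i ∈ Finset.range (D + 1), algebraMap K R (A.coeff i) * p ^ i * q ^ (D - i)

lemma auxHm_field {L : Type*} [Field L] [Algebra K L] {D : ℕ} {A : K[X]}
    (hA : A.natDegree ≤ D) (p q : L) (hq : q ≠ 0) :
    auxHm D A p q = q ^ D * aeval (p / q) A := by
  rw [aeval_eq_sum_range' (Nat.lt_succ_of_le hA), Finset.mul_sum]
  apply Finset.sum_congr rfl
  intro i hi
  have hi : i ≤ D := by simpa [Nat.lt_succ_iff] using hi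
  rw [Algebra.smul_def, div_pow]
  have : q ^ D = q ^ i * q ^ (D - i) := by rw [← pow_add, Nat.add_sub_cancel' hi]
  rw [this]
  field_simp

lemma auxHm_zero {L : Type*} [Field L] [Algebra K L] {D : ℕ} {A : K[X]} (p : L) :
    auxHm D A p 0 = p ^ D * algebraMap K L (A.coeff D) := by
  unfold auxHm
  rw [Finset.sum_range_succ, Finset.sum_eq_zero]
  · simp [mul_comm]
  · intro i hi
    have : D - i ≠ 0 := by simp at hi; omega
    simp [this]

lemma auxHm_map (D : ℕ) (A p q : K[X]) :
    algebraMap K[X] (RatFunc K) (auxHm D A p q) =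
      auxHm D A (algebraMap K[X] (RatFunc K) p) (algebraMap K[X] (RatFunc K) q) := by
  simp [auxHm]

/-- Homogenized evaluation agrees with values at the point `[u : v]` up to a common scalar. -/
lemma auxHm_pt (D : ℕ) (u v : K) (huv : u ≠ 0 ∨ v ≠ 0) : ∃ s : K, s ≠ 0 ∧
    ∀ A : K[X], A.natDegree ≤ D → auxHm D A u v = s * auxH D A (auxPt u v) := by
  by_cases hv : v = 0
  · subst hv
    have hu : u ≠ 0 := by tauto
    refine ⟨u ^ D, pow_ne_zero _ hu, fun A _ => ?_⟩
    rw [auxHm_zero]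
    simp [auxPt, auxH_infty]
  · refine ⟨v ^ D, pow_ne_zero _ hv, fun A hA => ?_⟩
    rw [auxHm_field hA u v hv]
    simp [auxPt, hv, auxH_coe, Polynomial.aeval_def]

lemma auxHm_natDegree {D r : ℕ} {A p q : K[X]} (hp : p.natDegree ≤ r) (hq : q.natDegree ≤ r) :
    (auxHm D A p q).natDegree ≤ D * r := by
  apply natDegree_sum_le_of_forall_le
  intro i hi
  have hi : i ≤ D := by simpa [Nat.lt_succ_iff] using hi
  rw [mul_assoc]
  refine (natDegree_C_mul_le _ _).trans (natDegree_mul_le.trans ?_)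
  have h1 := natDegree_pow_le_of_le i hp
  have h2 := natDegree_pow_le_of_le (D - i) hq
  calc _ ≤ i * r + (D - i) * r := add_le_add h1 h2
    _ = D * r := by rw [← add_mul, Nat.add_sub_cancel' hi]

lemma auxH_sum {ι : Type*} (s : Finset ι) (N : ℕ) (F : ι → K[X]) (b : OnePoint K) :
    auxH N (∑ i ∈ s, F i) b = ∑ i ∈ s, auxH N (F i) b := by
  induction b using OnePoint.rec with
  | infty => simp [auxH_infty]
  | coe b => simp [auxH_coe, eval_finsetSum]

lemma auxH_C_mul (N : ℕ) (c : K) (p : K[X]) (b : OnePoint K) :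
    auxH N (C c * p) b = c * auxH N p b := by
  induction b using OnePoint.rec with
  | infty => simp [auxH_infty]
  | coe b => simp [auxH_coe]

lemma auxH_auxHm {D r : ℕ} {A p q : K[X]} (hp : p.natDegree ≤ r) (hq : q.natDegree ≤ r)
    (b : OnePoint K) :
    auxH (D * r) (auxHm D A p q) b = auxHm D A (auxH r p b) (auxH r q b) := by
  unfold auxHm
  rw [auxH_sum]
  apply Finset.sum_congr rfl
  intro i hi
  have hi : i ≤ D := by simpa [Nat.lt_succ_iff] using hi
  have h1 := natDegree_pow_le_of_le i hp
  have h2 := natDegree_pow_le_of_le (D - i) hq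
  rw [mul_assoc, mul_assoc]
  have hD : D * r = i * r + (D - i) * r := by rw [← add_mul, Nat.add_sub_cancel' hi]
  rw [hD, show algebraMap K K[X] (A.coeff i) = C (A.coeff i) from rfl, auxH_C_mul,
    auxH_mul h1 h2, auxH_pow hp, auxH_pow hq]
  rfl


/-! ### Composition and iteration -/

/-- Numerator and denominator of the composition, in homogeneous form. -/
lemma rcomp_data (f h : RatFunc K) (hh : ¬ ∃ c, h = RatFunc.C c) :
    ∃ P Q : K[X], Q ≠ 0 ∧
      rcomp K f h = algebraMap K[X] (RatFunc K) P / algebraMap K[X] (RatFunc K) Q ∧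
      P.natDegree ≤ rdeg K f * rdeg K h ∧ Q.natDegree ≤ rdeg K f * rdeg K h ∧
      ∀ b : OnePoint K,
        (auxH (rdeg K f * rdeg K h) P b ≠ 0 ∨ auxH (rdeg K f * rdeg K h) Q b ≠ 0) ∧
        auxPt (auxH (rdeg K f * rdeg K h) P b) (auxH (rdeg K f * rdeg K h) Q b) =
          evalP1 K f (evalP1 K h b) := by
  have htr := h.transcendental_of_ne_C hh
  have hq0 : algebraMap K[X] (RatFunc K) h.denom ≠ 0 := by simpa using h.denom_ne_zero
  have key : ∀ A : K[X], A.natDegree ≤ rdeg K f →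
      algebraMap K[X] (RatFunc K) (auxHm (rdeg K f) A h.num h.denom) =
        (algebraMap K[X] (RatFunc K) h.denom) ^ rdeg K f * aeval h A := by
    intro A hA
    rw [auxHm_map, auxHm_field hA _ _ hq0, h.num_div_denom]
  have hB : aeval h f.denom ≠ 0 := by
    intro h0
    exact f.denom_ne_zero ((transcendental_iff.mp htr) _ h0)
  refine ⟨auxHm (rdeg K f) f.num h.num h.denom, auxHm (rdeg K f) f.denom h.num h.denom,
    ?_, ?_, auxHm_natDegree (num_le_rdeg h) (denom_le_rdeg h),
    auxHm_natDegree (num_le_rdeg h) (denom_le_rdeg h), ?_⟩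
  · intro h0
    have := key f.denom (denom_le_rdeg f)
    rw [h0, map_zero] at this
    exact mul_ne_zero (pow_ne_zero _ hq0) hB this.symm
  · rw [key _ (num_le_rdeg f), key _ (denom_le_rdeg f), mul_div_mul_left _ _ (pow_ne_zero _ hq0)]
    rfl
  · intro b
    obtain ⟨s, hs, hsA⟩ := auxHm_pt (rdeg K f) _ _ (auxH_ne h b)
    rw [auxH_auxHm (num_le_rdeg h) (denom_le_rdeg h), auxH_auxHm (num_le_rdeg h) (denom_le_rdeg h),
      hsA _ (num_le_rdeg f), hsA _ (denom_le_rdeg f), ← evalP1_eq]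
    have hne := auxH_ne f (evalP1 K h b)
    have hne' : s * auxH (rdeg K f) f.num (evalP1 K h b) ≠ 0 ∨
        s * auxH (rdeg K f) f.denom (evalP1 K h b) ≠ 0 := by
      simpa [hs] using hne
    refine ⟨hne', ?_⟩
    rw [evalP1_eq f]
    exact auxPt_eq hne' hne (by ring)

lemma evalP1_rcomp (f h : RatFunc K) (hh : ¬ ∃ c, h = RatFunc.C c) (b : OnePoint K) :
    evalP1 K (rcomp K f h) b = evalP1 K f (evalP1 K h b) := by
  obtain ⟨P, Q, hQ, he, hP, hQN, hb⟩ := rcomp_data f h hh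
  rw [← (hb b).2]
  exact evalP1_of_div hQ he hP hQN b (hb b).1

lemma nonconst_of_rdeg {f : RatFunc K} (hd : 1 < rdeg K f) : ¬ ∃ c, f = RatFunc.C c := by
  rintro ⟨c, rfl⟩
  simp [rdeg] at hd

lemma rcomp_nonconst {f h : RatFunc K} (hf : ¬ ∃ c, f = RatFunc.C c)
    (hh : ¬ ∃ c, h = RatFunc.C c) : ¬ ∃ c, rcomp K f h = RatFunc.C c := by
  rintro ⟨c, hc⟩
  have htr := h.transcendental_of_ne_C hh
  have hB : aeval h f.denom ≠ 0 := by
    intro h0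
    exact f.denom_ne_zero ((transcendental_iff.mp htr) _ h0)
  have h1 : aeval h f.num / aeval h f.denom = RatFunc.C c := hc
  rw [div_eq_iff hB] at h1
  have h2 : aeval h (f.num - C c * f.denom) = 0 := by
    simp [h1, RatFunc.algebraMap_eq_C]
  have h3 := (transcendental_iff.mp htr) _ h2
  apply hf
  refine ⟨c, ?_⟩
  have hd : algebraMap K[X] (RatFunc K) f.denom ≠ 0 := by simpa using f.denom_ne_zero
  rw [← f.num_div_denom, div_eq_iff hd, sub_eq_zero.mp h3]
  simp

lemma riter_nonconst {f : RatFunc K} (hd : 1 < rdeg K f) (n : ℕ) :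
    ¬ ∃ c, riter K f n = RatFunc.C c := by
  induction n with
  | zero =>
    rintro ⟨c, hc⟩
    have := congrArg RatFunc.num hc
    simp [riter] at this
    exact X_ne_C c this
  | succ n ih => exact rcomp_nonconst (nonconst_of_rdeg hd) ih

lemma evalP1_X (b : OnePoint K) : evalP1 K RatFunc.X b = b := by
  induction b using OnePoint.rec with
  | infty => rw [evalP1_infty]; simp
  | coe b => rw [evalP1_coe]; simp

lemma evalP1_riter {f : RatFunc K} (hd : 1 < rdeg K f) (n : ℕ) (b : OnePoint K) :
    evalP1 K (riter K f n) b = (evalP1 K f)^[n] b := by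
  induction n with
  | zero => simpa [riter] using evalP1_X b
  | succ n ih =>
    rw [Function.iterate_succ_apply', ← ih]
    exact evalP1_rcomp f _ (riter_nonconst hd n) b

lemma rdeg_pos {h : RatFunc K} (hh : ¬ ∃ c, h = RatFunc.C c) : 0 < rdeg K h := by
  by_contra h0
  have h0 : rdeg K h = 0 := by omega
  have h1 := num_le_rdeg h
  have h2 := denom_le_rdeg h
  rw [h0, Nat.le_zero] at h1 h2
  rw [natDegree_eq_zero] at h1 h2
  obtain ⟨x, hx⟩ := h1
  obtain ⟨y, hy⟩ := h2
  apply hh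
  refine ⟨x / y, ?_⟩
  rw [← h.num_div_denom, ← hx, ← hy]
  simp

lemma riter_succ_ne_X {f : RatFunc K} (hd : 1 < rdeg K f) (n : ℕ) :
    riter K f (n + 1) ≠ RatFunc.X := by
  intro hX
  have hh := riter_nonconst hd n
  obtain ⟨P, Q, hQ, he, hP, hQN, hb⟩ := rcomp_data f _ hh
  have hX : rcomp K f (riter K f n) = RatFunc.X := hX
  rw [hX] at he
  have hq : algebraMap K[X] (RatFunc K) Q ≠ 0 := by simpa using hQ
  have hPX : P = X * Q := by
    rw [eq_div_iff hq] at he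
    apply RatFunc.algebraMap_injective K
    rw [← he]; simp
  have hN : 1 < rdeg K f * rdeg K (riter K f n) :=
    lt_of_lt_of_le hd (Nat.le_mul_of_pos_right _ (rdeg_pos hh))
  have hQc : Q.degree = 0 := by
    by_contra hdeg
    obtain ⟨x, hx⟩ := IsAlgClosed.exists_root Q hdeg
    have := (hb x).1
    simp only [auxH_coe, hPX, IsRoot.def] at this hx
    simp [hx] at this
  have hQ0 : Q.natDegree = 0 := natDegree_eq_zero_iff_degree_le_zero.mpr hQc.le
  have := (hb OnePoint.infty).1
  simp only [auxH_infty] at this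
  rcases this with h | h
  · apply h
    apply coeff_eq_zero_of_natDegree_lt
    rw [hPX]
    refine lt_of_le_of_lt natDegree_mul_le ?_
    simpa [hQ0] using hN
  · exact h (coeff_eq_zero_of_natDegree_lt (by omega))

/-! ### The exceptional set is countable -/

lemma evalP1_surj {f : RatFunc K} (hf : ¬ ∃ c, f = RatFunc.C c) :
    Function.Surjective (evalP1 K f) := by
  -- a point `a = [s : t]` is attained where `t * num - s * denom` vanishes homogeneously
  have main : ∀ s t : K, s ≠ 0 ∨ t ≠ 0 → ∃ b, evalP1 K f b = auxPt s t := by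
    intro s t hst
    have hdist : ∃ b : OnePoint K, t * auxH (rdeg K f) f.num b = s * auxH (rdeg K f) f.denom b := by
      by_cases hdeg : (C t * f.num - C s * f.denom).degree = 0
      · refine ⟨OnePoint.infty, ?_⟩
        have h0 : (C t * f.num - C s * f.denom).natDegree < rdeg K f := by
          rw [natDegree_eq_zero_iff_degree_le_zero.mpr hdeg.le]
          exact rdeg_pos hf
        have := coeff_eq_zero_of_natDegree_lt h0
        simpa [auxH_infty, sub_eq_zero] using this
      · obtain ⟨x, hx⟩ := IsAlgClosed.exists_root _ hdeg
        refine ⟨x, ?_⟩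
        simpa [auxH_coe, sub_eq_zero] using hx
    obtain ⟨b, hb⟩ := hdist
    refine ⟨b, ?_⟩
    rw [evalP1_eq]
    exact auxPt_eq (auxH_ne f b) hst (by rw [← hb]; ring)
  intro a
  induction a using OnePoint.rec with
  | infty =>
    obtain ⟨b, hb⟩ := main 1 0 (by simp)
    exact ⟨b, by simpa [auxPt] using hb⟩
  | coe a =>
    obtain ⟨b, hb⟩ := main a 1 (by simp)
    exact ⟨b, by simpa [auxPt] using hb⟩

/-- A point with finite backward orbit under a surjective map is periodic. -/
lemma periodic_of_finite_backward {α : Type*} {F : α → α} (hF : Function.Surjective F) {a : α}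
    (ha : Set.Finite {b | ∃ n : ℕ, F^[n] b = a}) : ∃ n : ℕ, F^[n + 1] a = a := by
  choose G hG using hF
  have hGn : ∀ n, F^[n] (G^[n] a) = a := by
    intro n
    exact (Function.RightInverse.iterate hG n) a
  -- pigeonhole on the inverse orbit of `a`
  have hnot : ¬ Function.Injective (fun n : ℕ => G^[n] a) := by
    intro hinj
    have hsub : Set.range (fun n : ℕ => G^[n] a) ⊆ {b | ∃ n : ℕ, F^[n] b = a} := by
      rintro _ ⟨n, rfl⟩
      exact ⟨n, hGn n⟩
    exact Set.infinite_range_of_injective hinj (ha.subset hsub)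
  simp only [Function.Injective, not_forall] at hnot
  obtain ⟨m, n, hmn, hne⟩ := hnot
  wlog hlt : m < n generalizing m n
  · exact this n m hmn.symm (Ne.symm hne) (by omega)
  obtain ⟨k, rfl⟩ : ∃ k, n = (k + 1) + m := ⟨n - m - 1, by omega⟩
  refine ⟨k, ?_⟩
  have h1 := hGn (k + 1 + m)
  rw [Function.iterate_add_apply, ← hmn, hGn] at h1
  exact h1

lemma exceptional_countable {f : RatFunc K} (hd : 1 < rdeg K f) :
    Set.Countable {a : K | (a : OnePoint K) ∈ exceptionalSet K f} := by
  have hsub : {a : K | (a : OnePoint K) ∈ exceptionalSet K f} ⊆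
      ⋃ n : ℕ, {a : K | evalP1 K (riter K f (n + 1)) a = a} := by
    intro a ha
    obtain ⟨n, hn⟩ := periodic_of_finite_backward (evalP1_surj (nonconst_of_rdeg hd)) ha
    exact Set.mem_iUnion.mpr ⟨n, by rw [Set.mem_ofPred_eq, evalP1_riter hd, hn]⟩
  refine Set.Countable.mono hsub (Set.countable_iUnion fun n => ?_)
  apply Set.Finite.countable
  set h := riter K f (n + 1) with hh
  have hne : h.num - X * h.denom ≠ 0 := by
    intro h0
    apply riter_succ_ne_X hd n
    have hdn : algebraMap K[X] (RatFunc K) h.denom ≠ 0 := by simpa using h.denom_ne_zero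
    rw [← hh, ← h.num_div_denom, div_eq_iff hdn, sub_eq_zero.mp h0]
    simp
  refine (Polynomial.finite_setOfPred_isRoot hne).subset ?_
  intro a ha
  rw [Set.mem_ofPred_eq, evalP1_coe] at ha
  split_ifs at ha with h0
  · exact absurd ha (OnePoint.infty_ne_coe a)
  · have := OnePoint.coe_injective ha
    rw [div_eq_iff h0] at this
    simp [this]

lemma exists_two_nonexceptional {f : RatFunc K} (hd : 1 < rdeg K f) :
    ∃ a b : K, a ≠ b ∧ (a : OnePoint K) ∉ exceptionalSet K f ∧
      (b : OnePoint K) ∉ exceptionalSet K f := by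
  have hc := exceptional_countable hd
  have key : ∀ S : Set K, S.Countable → ∃ a, a ∉ S := by
    intro S hS
    have := (hS.dense_compl K).nonempty
    exact this
  obtain ⟨a, ha⟩ := key _ hc
  obtain ⟨b, hb⟩ := key _ (hc.insert a)
  rw [Set.mem_insert_iff, not_or] at hb
  exact ⟨a, b, fun h => hb.1 h.symm, ha, hb.2⟩

/-! ### Atoms of the pullback measures -/

lemma ordPull_ne_zero {h : RatFunc K} {a : K} {b : OnePoint K}
    (hne : ordPull K h (a : OnePoint K) b ≠ 0) : evalP1 K h b = a := by
  have hE : eqPoly K h (RatFunc.C a) = h.num - C a * h.denom := by simp [eqPoly]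
  induction b using OnePoint.rec with
  | infty =>
    have h1 : (rdeg K h + rdeg K (RatFunc.C a)) - (eqPoly K h (RatFunc.C a)).natDegree ≠ 0 := hne
    have h2 : rdeg K (RatFunc.C a) = 0 := by simp [rdeg]
    rw [h2, hE] at h1
    have h3 : (h.num - C a * h.denom).natDegree < rdeg K h := by omega
    have h4 := coeff_eq_zero_of_natDegree_lt h3
    rw [evalP1_eq, show (a : OnePoint K) = auxPt a 1 by simp [auxPt]]
    refine auxPt_eq (auxH_ne h _) (by simp) ?_
    simpa [auxH_infty, sub_eq_zero] using h4
  | coe b =>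
    have h1 : (eqPoly K h (RatFunc.C a)).rootMultiplicity b ≠ 0 := hne
    rw [hE] at h1
    have h4 : (h.num - C a * h.denom).IsRoot b := by
      by_contra h5
      exact h1 (rootMultiplicity_eq_zero h5)
    rw [evalP1_eq, show (a : OnePoint K) = auxPt a 1 by simp [auxPt]]
    refine auxPt_eq (auxH_ne h _) (by simp) ?_
    simpa [auxH_coe, sub_eq_zero] using h4

lemma pullMeasure_eq_zero {h : RatFunc K} {a : K} {U : Set (BerkP1 K)} (hU : IsOpen U)
    (hne : ∀ w : OnePoint K, iota K w ∈ U → evalP1 K h w ≠ a) :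
    pullMeasure K h (a : OnePoint K) U = 0 := by
  unfold pullMeasure
  rw [Measure.sum_apply _ hU.measurableSet, ENNReal.tsum_eq_zero]
  intro b
  rw [Measure.smul_apply, Measure.dirac_apply' _ hU.measurableSet]
  by_cases hb : iota K b ∈ U
  · have : ordPull K h (a : OnePoint K) b = 0 := by
      by_contra h0
      exact hne b hb (ordPull_ne_zero h0)
    simp [this]
  · simp [hb]

/-! ### Topology of the Berkovich line -/

lemma berk_inducing : IsInducing (BerkA1.toFun : BerkA1 K → K[X] → ℝ) := ⟨rfl⟩

lemma berk_injective : Function.Injective (BerkA1.toFun : BerkA1 K → K[X] → ℝ) := by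
  rintro ⟨x, _, _, _, _⟩ ⟨y, _, _, _, _⟩ h
  simpa using h

lemma berk_continuous (p : K[X]) : Continuous (fun x : BerkA1 K => x.toFun p) :=
  (continuous_apply p).comp berk_inducing.continuous

instance berk_t2 : T2Space (BerkA1 K) :=
  T2Space.of_injective_continuous berk_injective berk_inducing.continuous

lemma berk_pow (x : BerkA1 K) (n : ℕ) : x.toFun (X ^ n) = x.toFun X ^ n := by
  induction n with
  | zero =>
    have := x.restricts' 1
    simpa using this
  | succ n ih => rw [pow_succ, x.map_mul', ih, pow_succ]

lemma berk_bound (x : BerkA1 K) (p : K[X]) {R : ℝ} (hR : x.toFun X ≤ R) :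
    x.toFun p ≤ ∑ i ∈ Finset.range (p.natDegree + 1), ‖p.coeff i‖ * R ^ i := by
  have hsum : ∀ (s : Finset ℕ) (F : ℕ → K[X]),
      x.toFun (∑ i ∈ s, F i) ≤ ∑ i ∈ s, x.toFun (F i) := by
    intro s F
    induction s using Finset.induction_on with
    | empty =>
      have := x.restricts' 0
      simp at this
      simp [this]
    | insert a s ha ih =>
      rw [Finset.sum_insert ha, Finset.sum_insert ha]
      exact (x.add_le' _ _).trans (by gcongr)
  conv_lhs => rw [p.as_sum_range_C_mul_X_pow]
  refine (hsum _ _).trans (Finset.sum_le_sum fun i _ => ?_)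
  rw [x.map_mul', x.restricts', berk_pow]
  have := x.nonneg' X
  gcongr

lemma aux_isClosed_forall {ι α : Type*} [TopologicalSpace α] {p : ι → α → Prop}
    (h : ∀ i, IsClosed {x | p i x}) : IsClosed {x | ∀ i, p i x} := by
  have : {x | ∀ i, p i x} = ⋂ i, {x | p i x} := by
    ext x
    simp
  rw [this]
  exact isClosed_iInter h

lemma berk_isCompact (R : ℝ) : IsCompact {x : BerkA1 K | x.toFun X ≤ R} := by
  rw [berk_inducing.isCompact_iff]
  have hcpt : IsCompact (Set.pi Set.univ fun p : K[X] =>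
      Set.Icc (0 : ℝ) (∑ i ∈ Finset.range (p.natDegree + 1), ‖p.coeff i‖ * R ^ i)) :=
    isCompact_univ_pi fun p => isCompact_Icc
  refine hcpt.of_isClosed_subset ?_ ?_
  · have himg : (BerkA1.toFun : BerkA1 K → K[X] → ℝ) '' {x : BerkA1 K | x.toFun X ≤ R} =
        {F | (∀ p, 0 ≤ F p) ∧ (∀ p q, F (p * q) = F p * F q) ∧
          (∀ p q, F (p + q) ≤ F p + F q) ∧ (∀ c : K, F (C c) = ‖c‖) ∧ F X ≤ R} := by
      ext F
      constructor
      · rintro ⟨x, hx, rfl⟩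
        exact ⟨x.nonneg', x.map_mul', x.add_le', x.restricts', hx⟩
      · rintro ⟨h1, h2, h3, h4, h5⟩
        exact ⟨⟨F, h1, h2, h3, h4⟩, h5, rfl⟩
    rw [himg]
    refine IsClosed.and ?_ (IsClosed.and ?_ (IsClosed.and ?_ (IsClosed.and ?_ ?_)))
    · exact aux_isClosed_forall fun p => isClosed_le continuous_const (continuous_apply p)
    · exact aux_isClosed_forall fun p => aux_isClosed_forall fun q =>
        isClosed_eq (continuous_apply _) ((continuous_apply p).mul (continuous_apply q))
    · exact aux_isClosed_forall fun p => aux_isClosed_forall fun q =>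
        isClosed_le (continuous_apply _) ((continuous_apply p).add (continuous_apply q))
    · exact aux_isClosed_forall fun c => isClosed_eq (continuous_apply _) continuous_const
    · exact isClosed_le (continuous_apply _) continuous_const
  · rintro _ ⟨x, hx, rfl⟩ p _
    exact ⟨x.nonneg' p, berk_bound x p hx⟩

instance berk_wlc : WeaklyLocallyCompactSpace (BerkA1 K) where
  exists_compact_mem_nhds x := by
    refine ⟨_, berk_isCompact (x.toFun X + 1), ?_⟩
    have : {y : BerkA1 K | y.toFun X < x.toFun X + 1} ∈ 𝓝 x :=
      (isOpen_lt (berk_continuous X) continuous_const).mem_nhds (by simp)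
    filter_upwards [this] with y hy
    exact le_of_lt hy

/-- The standard neighbourhood of infinity. -/
lemma berk_open_infty (R : ℝ) :
    IsOpen (((↑) : BerkA1 K → OnePoint (BerkA1 K)) '' {x : BerkA1 K | x.toFun X ≤ R})ᶜ := by
  rw [OnePoint.isOpen_compl_image_coe]
  exact ⟨isClosed_le (berk_continuous X) continuous_const, berk_isCompact R⟩

lemma iota_infty : iota K OnePoint.infty = OnePoint.infty := rfl

lemma iota_coe (b : K) : iota K (b : OnePoint K) = ((evalSeminorm K b : BerkA1 K) : BerkP1 K) := rfl

/-! ### Chordal distance -/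

lemma chordal_auxPt (a u v : K) (huv : u ≠ 0 ∨ v ≠ 0) :
    chordal K (a : OnePoint K) (auxPt u v) =
      ‖u - a * v‖ / (max ‖a‖ 1 * max ‖u‖ ‖v‖) := by
  have ha : homCoord K (a : OnePoint K) = (a, 1) := rfl
  by_cases hv : v = 0
  · subst hv
    have hu : ‖u‖ ≠ 0 := by simpa using huv
    have hpt : auxPt u 0 = OnePoint.infty := by simp [auxPt]
    have hi : homCoord K (OnePoint.infty : OnePoint K) = (1, 0) := rfl
    rw [hpt, chordal, ha, hi]
    have : 0 < max ‖a‖ 1 := lt_max_of_lt_right one_pos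
    simp
    field_simp
  · have hpt : auxPt u v = ((u / v : K) : OnePoint K) := by simp [auxPt, hv]
    have hi : homCoord K ((u / v : K) : OnePoint K) = (u / v, 1) := rfl
    rw [hpt, chordal, ha, hi]
    have hv' : 0 < ‖v‖ := by simpa using hv
    have h1 : ‖a * 1 - 1 * (u / v)‖ = ‖u - a * v‖ / ‖v‖ := by
      rw [← norm_div, ← norm_neg]
      congr 1
      field_simp
      ring
    have h2 : max ‖u / v‖ ‖(1 : K)‖ = max ‖u‖ ‖v‖ / ‖v‖ := by
      rw [← max_div_div_right hv'.le, norm_div, norm_one, div_self hv'.ne']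
    simp only [h1, h2]
    rw [norm_one]
    field_simp

lemma chordal_gt {a u v : K} {ε : ℝ} (hε : 0 < ε) (h : ε * max ‖u‖ ‖v‖ < ‖u - a * v‖) :
    ε / max ‖a‖ 1 < chordal K (a : OnePoint K) (auxPt u v) := by
  have huv : u ≠ 0 ∨ v ≠ 0 := by
    by_contra! hc
    simp [hc.1, hc.2] at h
  rw [chordal_auxPt a u v huv]
  have h1 : 0 < max ‖a‖ 1 := lt_max_of_lt_right one_pos
  have h2 : 0 < max ‖u‖ ‖v‖ := by
    rcases huv with h | h
    · exact lt_max_of_lt_left (by simpa using h)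
    · exact lt_max_of_lt_right (by simpa using h)
  rw [div_lt_div_iff₀ h1 (by positivity)]
  nlinarith

lemma eps_exists (m c : ℝ) (hm : 0 < c) (h0 : 0 ≤ m) : ∃ ε : ℝ, 0 < ε ∧ ε * m < c := by
  refine ⟨c / (m + 1), by positivity, ?_⟩
  rw [div_mul_eq_mul_div, div_lt_iff₀ (by positivity)]
  nlinarith

/-- Near any point of the Berkovich line, `g` stays away from one of two given points. -/
lemma local_avoid (g : RatFunc K) {a b : K} (hab : a ≠ b) (x : BerkP1 K) :
    ∃ c : K, (c = a ∨ c = b) ∧ ∃ ε : ℝ, 0 < ε ∧ ∃ U : Set (BerkP1 K), IsOpen U ∧ x ∈ U ∧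
      ∀ w : OnePoint K, iota K w ∈ U → ε < chordal K (c : OnePoint K) (evalP1 K g w) := by
  induction x using OnePoint.rec with
  | infty =>
    have hc : ∃ c, (c = a ∨ c = b) ∧
        auxH (rdeg K g) g.num OnePoint.infty - c * auxH (rdeg K g) g.denom OnePoint.infty ≠ 0 := by
      by_contra! hcon
      have h1 := hcon a (Or.inl rfl)
      have h2 := hcon b (Or.inr rfl)
      have h3 : (b - a) * auxH (rdeg K g) g.denom OnePoint.infty = 0 := by linear_combination h1 - h2
      have h4 : auxH (rdeg K g) g.denom OnePoint.infty = 0 := by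
        rcases mul_eq_zero.mp h3 with h | h
        · exact absurd (sub_eq_zero.mp h).symm hab
        · exact h
      have h5 : auxH (rdeg K g) g.num OnePoint.infty = 0 := by simpa [h4] using h1
      rcases auxH_ne g OnePoint.infty with h | h
      · exact h h5
      · exact h h4
    obtain ⟨c, hcab, hc⟩ := hc
    obtain ⟨ε, hε, hεlt⟩ := eps_exists (max ‖auxH (rdeg K g) g.num OnePoint.infty‖
      ‖auxH (rdeg K g) g.denom OnePoint.infty‖) _ (norm_pos_iff.mpr hc)
      (le_max_of_le_left (norm_nonneg _))
    refine ⟨c, hcab, ε / max ‖c‖ 1, by positivity, ?_⟩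
    set N := rdeg K g with hN
    set p := reflect N g.num with hp
    set q := reflect N g.denom with hq
    have hp0 : p.eval 0 = g.num.coeff N := by
      rw [← coeff_zero_eq_eval_zero, hp, coeff_reflect, revAt_le (Nat.zero_le _), Nat.sub_zero]
    have hq0 : q.eval 0 = g.denom.coeff N := by
      rw [← coeff_zero_eq_eval_zero, hq, coeff_reflect, revAt_le (Nat.zero_le _), Nat.sub_zero]
    have hopen : IsOpen {t : K | ε * max ‖p.eval t‖ ‖q.eval t‖ < ‖p.eval t - c * q.eval t‖} := by
      apply isOpen_lt <;> fun_prop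
    have h0 : (0 : K) ∈ {t : K | ε * max ‖p.eval t‖ ‖q.eval t‖ < ‖p.eval t - c * q.eval t‖} := by
      rw [Set.mem_ofPred_eq, hp0, hq0]
      exact hεlt
    obtain ⟨δ, hδ, hball⟩ := Metric.isOpen_iff.mp hopen 0 h0
    refine ⟨_, berk_open_infty δ⁻¹, ?_, ?_⟩
    · simp
    · intro w hw
      rw [evalP1_eq]
      apply chordal_gt hε
      induction w using OnePoint.rec with
      | infty => exact hεlt
      | coe w =>
        have hw' : δ⁻¹ < ‖w‖ := by
          by_contra hcon
          apply hw
          refine ⟨evalSeminorm K w, ?_, (iota_coe w).symm⟩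
          simpa [evalSeminorm] using hcon
        have hw0 : 0 < ‖w‖ := lt_trans (by positivity) hw'
        have hwne : w ≠ 0 := norm_pos_iff.mp hw0
        have hmem := hball (show w⁻¹ ∈ Metric.ball (0 : K) δ by
          rw [mem_ball_zero_iff, norm_inv]
          exact inv_lt_of_inv_lt₀ hδ hw')
        have hrefl : ∀ r : K[X], r.natDegree ≤ N → r.eval w = (reflect N r).eval w⁻¹ * w ^ N := by
          intro r hr
          have : Invertible w := invertibleOfNonzero hwne
          have := eval₂_reflect_mul_pow (RingHom.id K) w N r hr
          rw [invOf_eq_inv] at this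
          exact this.symm
        rw [auxH_coe, auxH_coe, hrefl _ (num_le_rdeg g), hrefl _ (denom_le_rdeg g)]
        have hmem : ε * max ‖p.eval w⁻¹‖ ‖q.eval w⁻¹‖ < ‖p.eval w⁻¹ - c * q.eval w⁻¹‖ := hmem
        have hwN : 0 < ‖w‖ ^ N := by positivity
        rw [← mul_assoc, ← sub_mul, norm_mul, norm_mul, norm_mul, norm_pow,
          ← max_mul_of_nonneg _ _ hwN.le, ← mul_assoc]
        exact mul_lt_mul_of_pos_right hmem hwN
  | coe x =>
    have hz : ∀ p : K[X], x.toFun (-p) = x.toFun p := by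
      intro p
      have := x.map_mul' (C (-1)) p
      rw [x.restricts'] at this
      simpa using this
    have hsub : ∀ p q : K[X], x.toFun p = 0 → x.toFun q = 0 → x.toFun (p - q) = 0 := by
      intro p q h1 h2
      apply le_antisymm _ (x.nonneg' _)
      rw [sub_eq_add_neg]
      refine (x.add_le' _ _).trans ?_
      rw [hz, h1, h2, add_zero]
    have hmul : ∀ p q : K[X], x.toFun q = 0 → x.toFun (p * q) = 0 := by
      intro p q h
      rw [x.map_mul', h, mul_zero]
    have hc : ∃ c, (c = a ∨ c = b) ∧ x.toFun (g.num - C c * g.denom) ≠ 0 := by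
      by_contra! hcon
      have h1 := hcon a (Or.inl rfl)
      have h2 := hcon b (Or.inr rfl)
      have hba : b - a ≠ 0 := sub_ne_zero.mpr hab.symm
      have h3 : x.toFun g.denom = 0 := by
        have := hmul (C (b - a)⁻¹) _ (hsub _ _ h1 h2)
        rwa [show C (b - a)⁻¹ * (g.num - C a * g.denom - (g.num - C b * g.denom)) =
          C ((b - a)⁻¹ * (b - a)) * g.denom by simp only [C_mul, C_sub]; ring,
          inv_mul_cancel₀ hba, C_1, one_mul] at this
      have h4 : x.toFun g.num = 0 := by
        have := hsub _ _ h1 (hmul (-C a) _ h3)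
        rwa [show g.num - C a * g.denom - (-C a) * g.denom = g.num by ring] at this
      obtain ⟨u, v, huv⟩ := g.isCoprime_num_denom
      have h5 := hsub _ _ (hmul u _ h4) (hmul (-v) _ h3)
      rw [show u * g.num - (-v) * g.denom = C 1 by rw [C_1, ← huv]; ring, x.restricts'] at h5
      simp at h5
    obtain ⟨c, hcab, hc⟩ := hc
    obtain ⟨ε, hε, hεlt⟩ := eps_exists (max (x.toFun g.num) (x.toFun g.denom)) _
      (lt_of_le_of_ne (x.nonneg' _) hc.symm) (le_max_of_le_left (x.nonneg' _))
    refine ⟨c, hcab, ε / max ‖c‖ 1, by positivity,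
      ((↑) : BerkA1 K → OnePoint (BerkA1 K)) '' {y : BerkA1 K |
        ε * max (y.toFun g.num) (y.toFun g.denom) < y.toFun (g.num - C c * g.denom)}, ?_, ?_, ?_⟩
    · rw [OnePoint.isOpen_image_coe]
      exact isOpen_lt (continuous_const.mul ((berk_continuous _).max (berk_continuous _)))
        (berk_continuous _)
    · exact ⟨x, hεlt, rfl⟩
    · intro w hw
      induction w using OnePoint.rec with
      | infty =>
        obtain ⟨y, _, hy⟩ := hw
        exact absurd hy (OnePoint.coe_ne_infty y)
      | coe w =>
        obtain ⟨y, hy, hyw⟩ := hw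
        rw [iota_coe] at hyw
        have hyw := OnePoint.coe_injective hyw
        subst hyw
        rw [evalP1_eq]
        apply chordal_gt hε
        simpa [evalSeminorm, auxH_coe] using hy

end aux

/-- If `μ` is a Radon probability measure towards which all pullbacks
`d⁻ⁿ (fⁿ)^* δ_a` (`a` non-exceptional) equidistribute, and on an open set
`D ⊆ P^1_Berk(K)` some subsequence of iterates of `f` converges uniformly on the classical
points of `D` (w.r.t. the chordal metric) to a rational function `g`, then `D` is disjoint
from the support of `μ`. -/
theorem open_subset_of_uniform_convergence_disjoint_from_support (f : RatFunc K)
    (hd : 1 < rdeg K f) (μ : Measure (BerkP1 K)) (hμp : IsProbabilityMeasure μ)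
    (hμr : μ.Regular)
    (hμ : ∀ a : OnePoint K, a ∉ exceptionalSet K f →
      WeakTendsto K
        (fun n => (((rdeg K f : ENNReal)) ^ n)⁻¹ • pullMeasure K (riter K f n) a) μ)
    (D : Set (BerkP1 K)) (hD : IsOpen D) (nj : ℕ → ℕ) (hnj : Tendsto nj atTop atTop)
    (g : RatFunc K)
    (hunif : ∀ ε : ℝ, 0 < ε → ∀ᶠ j : ℕ in atTop, ∀ w : OnePoint K, iota K w ∈ D →
      chordal K ((evalP1 K f)^[nj j] w) (evalP1 K g w) ≤ ε) :
    D ∩ msupport K μ = ∅ := by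
  rw [Set.eq_empty_iff_forall_notMem]
  rintro x ⟨hxD, hxs⟩
  obtain ⟨a, b, hab, ha, hb⟩ := exists_two_nonexceptional hd
  obtain ⟨c, hc, ε, hε, U, hU, hxU, hUw⟩ := local_avoid g hab x
  have hcE : (c : OnePoint K) ∉ exceptionalSet K f := by
    rcases hc with rfl | rfl
    · exact ha
    · exact hb
  have hUD : IsOpen (U ∩ D) := hU.inter hD
  -- a bump function at `x` supported in `U ∩ D`
  obtain ⟨φ, hφ0, hφ1, hφ⟩ := exists_continuous_zero_one_of_isClosed
    (X := BerkP1 K) (s := (U ∩ D)ᶜ) (t := {x}) hUD.isClosed_compl isClosed_singleton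
    (by rw [Set.disjoint_singleton_right]; simp [hxU, hxD])
  have hzero : ∀ᶠ j in atTop, ∫ y, φ y ∂((((rdeg K f : ENNReal)) ^ (nj j))⁻¹ •
      pullMeasure K (riter K f (nj j)) (c : OnePoint K)) = 0 := by
    filter_upwards [hunif ε hε] with j hj
    have hm : pullMeasure K (riter K f (nj j)) (c : OnePoint K) (U ∩ D) = 0 := by
      apply pullMeasure_eq_zero hUD
      intro w hw heq
      rw [evalP1_riter hd] at heq
      have h1 := hj w hw.2
      rw [heq] at h1
      exact absurd h1 (not_le.mpr (hUw w hw.1))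
    rw [integral_smul_measure]
    have : φ =ᵐ[pullMeasure K (riter K f (nj j)) (c : OnePoint K)] 0 := by
      rw [Filter.EventuallyEq, ae_iff]
      refine measure_mono_null ?_ hm
      intro y hy
      by_contra hy'
      exact hy (hφ0 hy')
    rw [integral_congr_ae this]
    simp
  have hlim := (hμ c hcE φ).comp hnj
  have hint : ∫ y, φ y ∂μ = 0 := by
    refine tendsto_nhds_unique hlim ?_
    refine tendsto_const_nhds.congr' ?_
    filter_upwards [hzero] with j hj
    exact hj.symm
  have hφi : Integrable φ μ := by
    refine Integrable.of_bound (C := 1) φ.continuous.aestronglyMeasurable ?_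
    refine Filter.Eventually.of_forall fun y => ?_
    rw [Real.norm_eq_abs, abs_of_nonneg (hφ y).1]
    exact (hφ y).2
  rw [integral_eq_zero_iff_of_nonneg (fun y => (hφ y).1) hφi] at hint
  have hpos := hxs {y | φ y ≠ 0} (isOpen_ne_fun φ.continuous continuous_const)
    (by
      have : φ x = 1 := hφ1 rfl
      simp [this])
  have : μ {y | φ y ≠ 0} = 0 := by
    rw [Filter.EventuallyEq, ae_iff] at hint
    exact hint
  exact absurd this hpos.ne'
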